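/- arXiv:1606.00395 — 3 statements merged into one kernel-verified Lean document; each statement's English description precedes it below -/
import Mathlib

section
/- Let n be a positive integer and λ an infinite cardinal. Every feebly compact T1 topology τ on exp_n λ for which the operation (x, y) ↦ x ∩ y is jointly continuous is countably compact (and hence compact). -/
open Set Filter Topology TopologicalSpace

/-- `Expn Λ n` is the semilattice `exp_n λ`: all subsets of `λ` of cardinality at most `n`. -/
abbrev Expn (Λ : Type*) [DecidableEq Λ] (n : ℕ) := {s : Finset Λ // s.card ≤ n}

/-- The semilattice operation on `exp_n λ`: intersection. -/
def Expn.inter {Λ : Type*} [DecidableEq Λ] {n : ℕ} (a b : Expn Λ n) : Expn Λ n :=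
  ⟨a.1 ∩ b.1, le_trans (Finset.card_le_card Finset.inter_subset_left) a.2⟩

/-- The upper set `↑x = {y ∈ exp_n λ : x ⊆ y}`. -/
def Expn.up {Λ : Type*} [DecidableEq Λ] {n : ℕ} (x : Expn Λ n) : Set (Expn Λ n) :=
  {y | x.1 ⊆ y.1}

/-- A space is countably compact if every countable open cover has a finite subcover. -/
def CountablyCompactSp (X : Type*) [TopologicalSpace X] : Prop :=
  ∀ U : ℕ → Set X, (∀ i, IsOpen (U i)) → (⋃ i, U i) = Set.univ →
    ∃ t : Finset ℕ, (⋃ i ∈ t, U i) = Set.univ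

/-- A space is feebly compact if every locally finite open cover is finite. -/
def FeeblyCompactSp (X : Type*) [TopologicalSpace X] : Prop :=
  ∀ 𝒰 : Set (Set X), (∀ U ∈ 𝒰, IsOpen U) → ⋃₀ 𝒰 = Set.univ →
    LocallyFinite (fun U : 𝒰 => (U : Set X)) → 𝒰.Finite

/-- In a feebly compact space, a set of isolated points without accumulation points is finite. -/
theorem FeeblyCompactSp.finite_of_isOpen_singleton {X : Type*} [TopologicalSpace X]
    (hfc : FeeblyCompactSp X) {D : Set X} (hD : ∀ d ∈ D, IsOpen {d})
    (hacc : ∀ z, ∃ W ∈ 𝓝 z, (W ∩ D).Finite) : D.Finite := by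
  have hfin : (insert univ (singleton '' D) : Set (Set X)).Finite := by
    refine hfc _ ?_ ?_ ?_
    · rintro U (rfl | ⟨d, hd, rfl⟩)
      exacts [isOpen_univ, hD d hd]
    · exact eq_univ_of_univ_subset (subset_sUnion_of_mem (mem_insert _ _))
    · intro z
      obtain ⟨W, hW, hWD⟩ := hacc z
      refine ⟨W, hW, Finite.of_finite_image (f := Subtype.val) ?_ Subtype.val_injective.injOn⟩
      refine ((hWD.image singleton).insert univ).subset ?_
      rintro _ ⟨⟨U, rfl | ⟨d, hd, rfl⟩⟩, hU, rfl⟩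
      · exact mem_insert _ _
      · obtain ⟨e, he, heW⟩ := hU
        exact mem_insert_of_mem _ ⟨d, ⟨eq_of_mem_singleton he ▸ heW, hd⟩, rfl⟩
  exact Finite.of_finite_image (hfin.subset (subset_insert _ _)) singleton_injective.injOn

namespace Expn

variable {Λ : Type*} [DecidableEq Λ] {n : ℕ}

theorem inter_eq_left_iff {x y : Expn Λ n} : inter x y = x ↔ y ∈ up x := by
  simp [inter, up, Subtype.ext_iff]

theorem up_eq_singleton {x : Expn Λ n} (hx : x.1.card = n) : up x = {x} := by
  ext y
  refine ⟨fun h => ?_, ?_⟩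
  · exact Subtype.ext (Finset.eq_of_subset_of_card_le h (y.2.trans hx.ge)).symm
  · rintro rfl
    exact Finset.Subset.refl _

theorem exists_inter_eq_of_disjoint [Infinite Λ] {y : Expn Λ n} {F : Finset Λ}
    (hyF : Disjoint y.1 F) :
    ∃ a b : Expn Λ n, a.1.card = n ∧ b.1.card = n ∧ inter a b = y ∧
      Disjoint a.1 F ∧ Disjoint b.1 F := by
  have key : ∀ G : Finset Λ, Disjoint y.1 G →
      ∃ a : Expn Λ n, a.1.card = n ∧ y.1 ⊆ a.1 ∧ Disjoint a.1 G := by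
    intro G hG
    obtain ⟨A, hA, hAc⟩ :=
      (y.1 ∪ G).finite_toSet.infinite_compl.exists_subset_card_eq (n - y.1.card)
    have hdisj : Disjoint A (y.1 ∪ G) := by
      rw [Finset.disjoint_left]
      exact fun a ha h => hA ha h
    rw [Finset.disjoint_union_right] at hdisj
    have hc : (y.1 ∪ A).card = n := by
      rw [Finset.card_union_of_disjoint hdisj.1.symm, hAc, Nat.add_sub_cancel' y.2]
    exact ⟨⟨y.1 ∪ A, hc.le⟩, hc, Finset.subset_union_left,
      Finset.disjoint_union_left.2 ⟨hG, hdisj.2⟩⟩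
  obtain ⟨a, ha, hya, haF⟩ := key F hyF
  obtain ⟨b, hb, hyb, hbF⟩ := key (F ∪ (a.1 \ y.1))
    (Finset.disjoint_union_right.2 ⟨hyF, Finset.disjoint_sdiff⟩)
  rw [Finset.disjoint_union_right] at hbF
  refine ⟨a, b, ha, hb, Subtype.ext (Finset.Subset.antisymm ?_ (Finset.subset_inter hya hyb)),
    haF, hbF.1⟩
  intro c hc
  obtain ⟨hca, hcb⟩ := Finset.mem_inter.1 hc
  by_contra hcy
  exact Finset.disjoint_left.1 hbF.2 hcb (Finset.mem_sdiff.2 ⟨hca, hcy⟩)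

variable [TopologicalSpace (Expn Λ n)] [T1Space (Expn Λ n)]

theorem isClopen_up
    (hjoint : Continuous fun p : Expn Λ n × Expn Λ n => inter p.1 p.2) (x : Expn Λ n) :
    IsClopen (up x) := by
  have hcont : Continuous (inter x) := hjoint.comp (Continuous.prodMk_right x)
  constructor
  · convert (isClosed_singleton (x := x)).preimage hcont using 1
    ext y
    exact inter_eq_left_iff.symm
  · have hfin : {z : Expn Λ n | z.1 ⊆ x.1 ∧ z ≠ x}.Finite := by
      refine Finite.of_finite_image (f := Subtype.val) ?_ Subtype.val_injective.injOn
      refine x.1.powerset.finite_toSet.subset ?_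
      rintro _ ⟨z, hz, rfl⟩
      simpa using hz.1
    convert hfin.isClosed.isOpen_compl.preimage hcont using 1
    ext y
    simp only [mem_preimage, mem_compl_iff, mem_ofPred_eq, ← inter_eq_left_iff, not_and, not_not]
    exact ⟨fun h _ => h, fun h => h Finset.inter_subset_left⟩

/-- A sunflower of sets of size `n` converges to its kernel. -/
theorem finite_setOf_notMem_of_sunflower (hfc : FeeblyCompactSp (Expn Λ n))
    (hjoint : Continuous fun p : Expn Λ n × Expn Λ n => inter p.1 p.2)
    {ι : Type*} {f : ι → Expn Λ n} (hf : Function.Injective f) (hcard : ∀ i, (f i).1.card = n)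
    {x : Expn Λ n} (hx : ∀ i, x.1 ⊆ (f i).1)
    (hinter : ∀ i j, i ≠ j → (f i).1 ∩ (f j).1 ⊆ x.1) {V : Set (Expn Λ n)} (hV : V ∈ 𝓝 x) :
    {i | f i ∉ V}.Finite := by
  refine Finite.of_finite_image (f := f) ?_ hf.injOn
  refine hfc.finite_of_isOpen_singleton ?_ fun z => ?_
  · rintro _ ⟨i, -, rfl⟩
    exact up_eq_singleton (hcard i) ▸ (isClopen_up hjoint (f i)).isOpen
  by_cases hxz : x.1 ⊆ z.1
  · by_cases hzx : z.1 ⊆ x.1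
    · obtain rfl : x = z := Subtype.ext (hxz.antisymm hzx)
      refine ⟨V, hV, finite_empty.subset ?_⟩
      rintro _ ⟨hiV, i, hi, rfl⟩
      exact hi hiV
    · refine ⟨up z, (isClopen_up hjoint z).isOpen.mem_nhds (Finset.Subset.refl _), ?_⟩
      refine Set.Subsingleton.finite ?_
      rintro _ ⟨hi, i, -, rfl⟩ _ ⟨hj, j, -, rfl⟩
      by_contra hij
      exact hzx ((Finset.subset_inter hi hj).trans (hinter i j fun h => hij (h ▸ rfl)))
  · refine ⟨(up x)ᶜ, (isClopen_up hjoint x).compl.isOpen.mem_nhds hxz, finite_empty.subset ?_⟩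
    rintro _ ⟨hi, i, -, rfl⟩
    exact hi (hx i)

theorem exists_finset_forall_disjoint_mem [Infinite Λ] (hfc : FeeblyCompactSp (Expn Λ n))
    (hjoint : Continuous fun p : Expn Λ n × Expn Λ n => inter p.1 p.2)
    {x : Expn Λ n} {U : Set (Expn Λ n)} (hU : U ∈ 𝓝 x) :
    ∃ F : Finset Λ, Disjoint x.1 F ∧ ∀ y ∈ up x, Disjoint y.1 F → y ∈ U := by
  by_contra! hcon
  obtain ⟨f, hfP, hfr⟩ := exists_seq_of_forall_finset_exists
    (fun p : Expn Λ n × Expn Λ n => p.1.1.card = n ∧ p.2.1.card = n ∧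
      x.1 ⊆ (inter p.1 p.2).1 ∧ inter p.1 p.2 ∉ U)
    (fun p q => p.1.1 ∩ q.1.1 ⊆ x.1 ∧ p.2.1 ∩ q.2.1 ⊆ x.1) (by
      intro s _
      obtain ⟨y, hxy, hyF, hyU⟩ :=
        hcon ((s.biUnion fun p => p.1.1 ∪ p.2.1) \ x.1) Finset.disjoint_sdiff
      obtain ⟨a, b, ha, hb, rfl, haF, hbF⟩ := exists_inter_eq_of_disjoint hyF
      refine ⟨(a, b), ⟨ha, hb, hxy, hyU⟩, fun p hp => ⟨fun c hc => ?_, fun c hc => ?_⟩⟩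
      all_goals
        rw [Finset.mem_inter] at hc
        by_contra hcx
      · refine Finset.disjoint_left.1 haF hc.2 (Finset.mem_sdiff.2 ⟨?_, hcx⟩)
        exact Finset.mem_biUnion.2 ⟨p, hp, Finset.mem_union_left _ hc.1⟩
      · refine Finset.disjoint_left.1 hbF hc.2 (Finset.mem_sdiff.2 ⟨?_, hcx⟩)
        exact Finset.mem_biUnion.2 ⟨p, hp, Finset.mem_union_right _ hc.1⟩)
  have hr : ∀ i j, i ≠ j →
      (f i).1.1 ∩ (f j).1.1 ⊆ x.1 ∧ (f i).2.1 ∩ (f j).2.1 ⊆ x.1 := by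
    intro i j hij
    rcases hij.lt_or_gt with h | h
    · exact hfr i j h
    · rw [Finset.inter_comm (f i).1.1, Finset.inter_comm (f i).2.1]
      exact hfr j i h
  have hne : ∀ i, inter (f i).1 (f i).2 ≠ x := fun i h =>
    (hfP i).2.2.2 (h ▸ mem_of_mem_nhds hU)
  have hinj₁ : Function.Injective fun i => (f i).1 := by
    intro i j (hij : (f i).1 = (f j).1)
    by_contra hne'
    have h := (hr i j hne').1
    rw [← hij, Finset.inter_self] at h
    exact hne i (Subtype.ext ((Finset.inter_subset_left.trans h).antisymm (hfP i).2.2.1))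
  have hinj₂ : Function.Injective fun i => (f i).2 := by
    intro i j (hij : (f i).2 = (f j).2)
    by_contra hne'
    have h := (hr i j hne').2
    rw [← hij, Finset.inter_self] at h
    exact hne i (Subtype.ext ((Finset.inter_subset_right.trans h).antisymm (hfP i).2.2.1))
  have hxx : inter x x = x := Subtype.ext (Finset.inter_self _)
  have hpre : (fun p : Expn Λ n × Expn Λ n => inter p.1 p.2) ⁻¹' U ∈ 𝓝 (x, x) :=
    hjoint.continuousAt.preimage_mem_nhds (by simpa only [hxx] using hU)
  rw [nhds_prod_eq, Filter.mem_prod_same_iff] at hpre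
  obtain ⟨V, hV, hVU⟩ := hpre
  have hfin₁ := finite_setOf_notMem_of_sunflower hfc hjoint hinj₁ (fun i => (hfP i).1)
    (fun i => (hfP i).2.2.1.trans Finset.inter_subset_left) (fun i j h => (hr i j h).1) hV
  have hfin₂ := finite_setOf_notMem_of_sunflower hfc hjoint hinj₂ (fun i => (hfP i).2.1)
    (fun i => (hfP i).2.2.1.trans Finset.inter_subset_right) (fun i j h => (hr i j h).2) hV
  obtain ⟨i, hi⟩ := (hfin₁.union hfin₂).infinite_compl.nonempty
  simp only [mem_compl_iff, mem_union, mem_ofPred_eq, not_or, not_not] at hi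
  exact (hfP i).2.2.2 (hVU (mk_mem_prod hi.1 hi.2))

theorem compactSpace_of_feeblyCompactSp [Infinite Λ] (hfc : FeeblyCompactSp (Expn Λ n))
    (hjoint : Continuous fun p : Expn Λ n × Expn Λ n => inter p.1 p.2) :
    CompactSpace (Expn Λ n) := by
  refine ⟨isCompact_iff_ultrafilter_le_nhds.2 fun u _ => ?_⟩
  have hmem : ∀ s : Finset Λ, (∀ a ∈ s, ∀ᶠ y : Expn Λ n in u, a ∈ y.1) →
      ∀ᶠ y : Expn Λ n in u, s ⊆ y.1 := fun s hs =>
    (s.eventually_all.2 hs).mono fun y hy a ha => hy a ha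
  have hcard : ∀ s : Finset Λ, (∀ a ∈ s, ∀ᶠ y : Expn Λ n in u, a ∈ y.1) → s.card ≤ n := by
    intro s hs
    obtain ⟨y, hy⟩ := (hmem s hs).exists
    exact (Finset.card_le_card hy).trans y.2
  have hfin : {a | ∀ᶠ y : Expn Λ n in u, a ∈ y.1}.Finite := by
    by_contra hinf
    obtain ⟨s, hs, hsc⟩ := Set.Infinite.exists_subset_card_eq hinf (n + 1)
    have := hcard s fun a ha => hs ha
    omega
  let x : Expn Λ n := ⟨hfin.toFinset, hcard _ fun a ha => by simpa using ha⟩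
  refine ⟨x, mem_univ _, fun U hU => ?_⟩
  obtain ⟨F, hxF, hFU⟩ := exists_finset_forall_disjoint_mem hfc hjoint hU
  have hx : ∀ᶠ y : Expn Λ n in u, x.1 ⊆ y.1 := hmem _ fun a ha => by simpa [x] using ha
  have hF : ∀ᶠ y : Expn Λ n in u, ∀ a ∈ F, a ∉ y.1 := by
    refine F.eventually_all.2 fun a ha => ?_
    rw [Ultrafilter.eventually_not]
    intro h
    exact Finset.disjoint_left.1 hxF (by simpa [x] using h) ha
  filter_upwards [hx, hF] with y hxy hyF
  exact hFU y hxy (Finset.disjoint_right.2 hyF)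

end Expn

theorem CompactSpace.countablyCompactSp (X : Type*) [TopologicalSpace X] [CompactSpace X] :
    CountablyCompactSp X := fun U hU hcov => by
  obtain ⟨t, ht⟩ := isCompact_univ.elim_finite_subcover U hU hcov.ge
  exact ⟨t, eq_univ_of_univ_subset ht⟩

/-- Every feebly compact `T1` topological semilattice topology on `exp_n λ` is
countably compact, and hence compact. -/
theorem feeblyCompact_topological_is_countablyCompact
    {Λ : Type*} [DecidableEq Λ] [Infinite Λ] (n : ℕ) (hn : 0 < n)
    [TopologicalSpace (Expn Λ n)] [T1Space (Expn Λ n)]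
    (hfc : FeeblyCompactSp (Expn Λ n))
    (hjoint : Continuous fun p : Expn Λ n × Expn Λ n => Expn.inter p.1 p.2) :
    CountablyCompactSp (Expn Λ n) ∧ CompactSpace (Expn Λ n) := by
  have := Expn.compactSpace_of_feeblyCompactSp hfc hjoint
  exact ⟨CompactSpace.countablyCompactSp _, this⟩
end

section
/- Let n be a positive integer and λ an infinite cardinal. Every semiregular feebly compact T1 topology τ on exp_n λ such that the operation (x, y) ↦ x ∩ y is separately continuous is compact, and hence the operation (x, y) ↦ x ∩ y is jointly continuous with respect to τ. -/
open Set Filter Topology TopologicalSpace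

/-- A space is countably pracompact if it has a dense subset `A` such that every infinite
subset of `A` has an accumulation point in the space. -/
def CountablyPracompactSp (X : Type*) [TopologicalSpace X] : Prop :=
  ∃ A : Set X, Dense A ∧ ∀ B ⊆ A, B.Infinite → ∃ x : X, AccPt x (Filter.principal B)

universe u v

/-- A Hausdorff space is H-closed if its image under any embedding into a Hausdorff space
is closed. -/
def HClosedSp (X : Type u) [TopologicalSpace X] : Prop :=
  ∀ (Y : Type v) (_ : TopologicalSpace Y), T2Space Y → ∀ f : X → Y,
    IsEmbedding f → IsClosed (Set.range f)

/-- A space is quasiregular if every nonempty open set contains a nonempty open set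
together with its closure. -/
def QuasiregularSp (X : Type*) [TopologicalSpace X] : Prop :=
  ∀ U : Set X, IsOpen U → U.Nonempty →
    ∃ V : Set X, IsOpen V ∧ V.Nonempty ∧ V ⊆ U ∧ closure V ⊆ U

/-- A space is semiregular if it has a base consisting of regular open sets. -/
def SemiregularSp (X : Type*) [TopologicalSpace X] : Prop :=
  ∃ B : Set (Set X), (∀ U ∈ B, interior (closure U) = U) ∧
    TopologicalSpace.IsTopologicalBasis B

namespace Expn

variable {Λ : Type*} [DecidableEq Λ] {n : ℕ}

/-- The basic neighbourhood of `x` consisting of the supersets of `x` that avoid `F`. -/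
def supersetsAvoiding (x : Expn Λ n) (F : Finset Λ) : Set (Expn Λ n) :=
  {y | x.1 ⊆ y.1 ∧ Disjoint y.1 F}

theorem exists_card_eq_mem_supersetsAvoiding [Infinite Λ] (x : Expn Λ n) {F : Finset Λ}
    (hF : Disjoint x.1 F) : ∃ y ∈ x.supersetsAvoiding F, y.1.card = n := by
  obtain ⟨t, ht, hcard⟩ :=
    (x.1 ∪ F).finite_toSet.infinite_compl.exists_subset_card_eq (n - x.1.card)
  have hmem : ∀ e ∈ t, e ∉ x.1 ∧ e ∉ F := fun e he => by
    simpa [not_or] using ht (Finset.mem_coe.2 he)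
  have hxt : Disjoint x.1 t := Finset.disjoint_right.2 fun e he => (hmem e he).1
  have hy : (x.1 ∪ t).card = n := by
    have := x.2
    rw [Finset.card_union_of_disjoint hxt]
    omega
  refine ⟨⟨x.1 ∪ t, hy.le⟩, ⟨Finset.subset_union_left, ?_⟩, hy⟩
  exact Finset.disjoint_union_left.2 ⟨hF, Finset.disjoint_left.2 fun e he => (hmem e he).2⟩

variable [TopologicalSpace (Expn Λ n)]

section Separation

variable [T1Space (Expn Λ n)]

theorem isClopen_setOf_mem (hn : 0 < n) (hsep : ∀ a : Expn Λ n, Continuous (inter a)) (e : Λ) :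
    IsClopen {y : Expn Λ n | e ∈ y.1} := by
  let a : Expn Λ n := ⟨{e}, by simpa using Nat.succ_le_of_lt hn⟩
  let z : Expn Λ n := ⟨∅, by simp⟩
  have h₁ : {y : Expn Λ n | e ∈ y.1} = inter a ⁻¹' {a} := by
    ext y
    simp [a, inter, Subtype.ext_iff]
  have h₂ : {y : Expn Λ n | e ∈ y.1}ᶜ = inter a ⁻¹' {z} := by
    ext y
    simp [a, z, inter, Subtype.ext_iff, ← Finset.disjoint_iff_inter_eq_empty]
  refine ⟨h₁ ▸ isClosed_singleton.preimage (hsep a), ?_⟩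
  rw [← isClosed_compl_iff, h₂]
  exact isClosed_singleton.preimage (hsep a)

theorem isOpen_supersetsAvoiding (hn : 0 < n) (hsep : ∀ a : Expn Λ n, Continuous (inter a))
    (x : Expn Λ n) (F : Finset Λ) : IsOpen (x.supersetsAvoiding F) := by
  have h : x.supersetsAvoiding F =
      (⋂ e ∈ x.1, {y : Expn Λ n | e ∈ y.1}) ∩ ⋂ e ∈ F, {y : Expn Λ n | e ∈ y.1}ᶜ := by
    ext y
    simp only [supersetsAvoiding, Finset.subset_iff, Finset.disjoint_right, Set.mem_ofPred_eq,
      Set.mem_inter_iff, Set.mem_iInter, Set.mem_compl_iff]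
  rw [h]
  exact (isOpen_biInter_finset fun e _ => (isClopen_setOf_mem hn hsep e).isOpen).inter
    (isOpen_biInter_finset fun e _ => (isClopen_setOf_mem hn hsep e).compl.isOpen)

theorem isOpen_singleton_of_card_eq (hn : 0 < n) (hsep : ∀ a : Expn Λ n, Continuous (inter a))
    {y : Expn Λ n} (hy : y.1.card = n) : IsOpen {y} := by
  have h : ({y} : Set (Expn Λ n)) = y.supersetsAvoiding ∅ := by
    ext z
    refine ⟨?_, fun hz => ?_⟩
    · rintro rfl
      simp [supersetsAvoiding]
    · exact (Subtype.ext (Finset.eq_of_subset_of_card_le hz.1 (z.2.trans hy.ge))).symm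
  rw [h]
  exact isOpen_supersetsAvoiding hn hsep y ∅

/-- An open neighbourhood of `x` contains all the maximal elements of some basic neighbourhood. -/
theorem exists_forall_card_eq_mem (hn : 0 < n) (hsep : ∀ a : Expn Λ n, Continuous (inter a))
    (hfc : FeeblyCompactSp (Expn Λ n)) {U : Set (Expn Λ n)} (hU : IsOpen U) {x : Expn Λ n}
    (hx : x ∈ U) : ∃ F : Finset Λ, Disjoint x.1 F ∧
      ∀ y ∈ x.supersetsAvoiding F, y.1.card = n → y ∈ U := by
  by_contra! hcon
  obtain ⟨y, hy, hdisj⟩ := exists_seq_of_forall_finset_exists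
    (fun y : Expn Λ n => x.1 ⊆ y.1 ∧ y.1.card = n ∧ y ∉ U)
    (fun y z => Disjoint (y.1 \ x.1) z.1) (fun s _ => by
      obtain ⟨y, hy, hcard, hyU⟩ := hcon (s.biUnion fun z => z.1 \ x.1)
        (Finset.disjoint_biUnion_right _ _ _ |>.2 fun z _ => Finset.disjoint_sdiff)
      exact ⟨y, ⟨hy.1, hcard, hyU⟩, fun z hz =>
        ((Finset.disjoint_biUnion_right _ _ _).1 hy.2 z hz).symm⟩)
  have hunique : ∀ e ∉ x.1, ∀ i j, e ∈ (y i).1 → e ∈ (y j).1 → i = j := by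
    intro e he i j hi hj
    rcases lt_trichotomy i j with h | h | h
    · exact (Finset.disjoint_left.1 (hdisj i j h) (Finset.mem_sdiff.2 ⟨hi, he⟩) hj).elim
    · exact h
    · exact (Finset.disjoint_left.1 (hdisj j i h) (Finset.mem_sdiff.2 ⟨hj, he⟩) hi).elim
  have hinj : Function.Injective y := by
    intro i j hij
    have hne : ¬ (y i).1 ⊆ x.1 := fun h =>
      (hy i).2.2 ((Subtype.ext (h.antisymm (hy i).1) : y i = x) ▸ hx)
    obtain ⟨e, he, hex⟩ := Finset.not_subset.1 hne
    exact hunique e hex i j he (hij ▸ he)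
  have hloc : ∀ z : Expn Λ n, ∃ V ∈ 𝓝 z, {i | y i ∈ V}.Finite := by
    intro z
    by_cases hxz : x.1 ⊆ z.1
    · by_cases hzx : z.1 ⊆ x.1
      · obtain rfl : x = z := Subtype.ext (hxz.antisymm hzx)
        exact ⟨U, hU.mem_nhds hx, Set.finite_empty.subset fun i hi => (hy i).2.2 hi⟩
      · obtain ⟨e, he, hex⟩ := Finset.not_subset.1 hzx
        refine ⟨_, (isClopen_setOf_mem hn hsep e).isOpen.mem_nhds he, Set.Subsingleton.finite ?_⟩
        exact fun i hi j hj => hunique e hex i j hi hj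
    · obtain ⟨e, he, hez⟩ := Finset.not_subset.1 hxz
      exact ⟨_, (isClopen_setOf_mem hn hsep e).compl.isOpen.mem_nhds hez,
        Set.finite_empty.subset fun i hi => hi ((hy i).1 he)⟩
  let 𝒰 : Set (Set (Expn Λ n)) := insert Set.univ (Set.range fun i => {y i})
  have hfin : 𝒰.Finite := by
    refine hfc 𝒰 ?_ ?_ ?_
    · rintro V (rfl | ⟨i, rfl⟩)
      · exact isOpen_univ
      · exact isOpen_singleton_of_card_eq hn hsep (hy i).2.1
    · exact Set.eq_univ_of_univ_subset (Set.subset_sUnion_of_mem (Set.mem_insert _ _))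
    · intro z
      obtain ⟨V, hV, hVfin⟩ := hloc z
      refine ⟨V, hV, Set.Finite.of_finite_image (f := Subtype.val) ?_
        Subtype.val_injective.injOn⟩
      refine ((hVfin.image fun i => ({y i} : Set (Expn Λ n))).insert Set.univ).subset ?_
      rintro _ ⟨⟨W, hW⟩, hWV, rfl⟩
      rcases hW with rfl | ⟨i, rfl⟩
      · exact Set.mem_insert _ _
      · refine Set.mem_insert_of_mem _ ⟨i, ?_, rfl⟩
        simpa using hWV
  exact Set.infinite_range_of_injective (Set.singleton_injective.comp hinj)
    (hfin.subset (Set.subset_insert _ _))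

theorem exists_supersetsAvoiding_subset [Infinite Λ] (hn : 0 < n)
    (hsep : ∀ a : Expn Λ n, Continuous (inter a)) (hsr : SemiregularSp (Expn Λ n))
    (hfc : FeeblyCompactSp (Expn Λ n)) {x : Expn Λ n} {U : Set (Expn Λ n)} (hU : U ∈ 𝓝 x) :
    ∃ F : Finset Λ, Disjoint x.1 F ∧ x.supersetsAvoiding F ⊆ U := by
  obtain ⟨B, hreg, hB⟩ := hsr
  obtain ⟨V, hVB, hxV, hVU⟩ := hB.mem_nhds_iff.1 hU
  obtain ⟨F, hF, hmax⟩ := exists_forall_card_eq_mem hn hsep hfc (hB.isOpen hVB) hxV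
  refine ⟨F, hF, Set.Subset.trans ?_ hVU⟩
  rw [← hreg V hVB]
  refine interior_maximal (fun z hz => mem_closure_iff.2 fun W hW hzW => ?_)
    (isOpen_supersetsAvoiding hn hsep x F)
  obtain ⟨G, hG, hmaxW⟩ := exists_forall_card_eq_mem hn hsep hfc
    (hW.inter (isOpen_supersetsAvoiding hn hsep x F)) ⟨hzW, hz⟩
  obtain ⟨y, hy, hcard⟩ := z.exists_card_eq_mem_supersetsAvoiding hG
  have h := hmaxW y hy hcard
  exact ⟨y, h.1, hmax y h.2 hcard⟩

end Separation

theorem compactSpace_of_exists_supersetsAvoiding_subset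
    (h : ∀ x : Expn Λ n, ∀ U ∈ 𝓝 x, ∃ F : Finset Λ, Disjoint x.1 F ∧ x.supersetsAvoiding F ⊆ U) :
    CompactSpace (Expn Λ n) := by
  refine ⟨isCompact_iff_ultrafilter_le_nhds.2 fun f _ => ?_⟩
  let S : Set Λ := {e | {y : Expn Λ n | e ∈ y.1} ∈ f}
  have hsub : ∀ s : Finset Λ, (s : Set Λ) ⊆ S → {y : Expn Λ n | s ⊆ y.1} ∈ f := by
    intro s hs
    have : (⋂ e ∈ s, {y : Expn Λ n | e ∈ y.1}) ∈ f := (Filter.biInter_finset_mem s).2 hs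
    refine Filter.mem_of_superset this fun y hy e he => ?_
    exact Set.mem_iInter₂.1 hy e he
  have hcard : ∀ s : Finset Λ, (s : Set Λ) ⊆ S → s.card ≤ n := fun s hs => by
    obtain ⟨y, hy⟩ := f.nonempty_of_mem (hsub s hs)
    exact (Finset.card_le_card hy).trans y.2
  have hS : S.Finite := by
    by_contra hinf
    obtain ⟨t, ht, hc⟩ := Set.Infinite.exists_subset_card_eq hinf (n + 1)
    have := hcard t ht
    omega
  let x : Expn Λ n := ⟨hS.toFinset, hcard _ (by simp)⟩
  refine ⟨x, Set.mem_univ _, fun U hU => ?_⟩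
  obtain ⟨F, hF, hFU⟩ := h x U hU
  have hFf : (⋂ e ∈ F, {y : Expn Λ n | e ∈ y.1}ᶜ) ∈ f :=
    (Filter.biInter_finset_mem F).2 fun e he =>
      Ultrafilter.compl_mem_iff_notMem.2 fun hes =>
        Finset.disjoint_right.1 hF he (hS.mem_toFinset.2 hes)
  refine Filter.mem_of_superset (Filter.inter_mem (hsub x.1 (by simp [x])) hFf) fun y hy => hFU ?_
  exact ⟨hy.1, Finset.disjoint_right.2 fun e he => Set.mem_iInter₂.1 hy.2 e he⟩

theorem continuous_inter_of_exists_supersetsAvoiding_subset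
    (hopen : ∀ (x : Expn Λ n) (F : Finset Λ), IsOpen (x.supersetsAvoiding F))
    (h : ∀ x : Expn Λ n, ∀ U ∈ 𝓝 x, ∃ F : Finset Λ, Disjoint x.1 F ∧ x.supersetsAvoiding F ⊆ U) :
    Continuous fun p : Expn Λ n × Expn Λ n => inter p.1 p.2 := by
  refine continuous_iff_continuousAt.2 fun ⟨a, b⟩ U hU => ?_
  obtain ⟨F, hF, hFU⟩ := h _ U hU
  have hnhds : ∀ c : Expn Λ n, c.supersetsAvoiding (F \ c.1) ∈ 𝓝 c := fun c =>
    (hopen c _).mem_nhds ⟨subset_rfl, Finset.disjoint_sdiff⟩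
  refine Filter.mem_map.2 (Filter.mem_of_superset (prod_mem_nhds (hnhds a) (hnhds b)) ?_)
  rintro ⟨y, z⟩ ⟨hy, hz⟩
  refine hFU ⟨Finset.inter_subset_inter hy.1 hz.1, Finset.disjoint_right.2 fun e he hmem => ?_⟩
  obtain ⟨hey, hez⟩ := Finset.mem_inter.1 hmem
  have hmem_of : ∀ c d : Expn Λ n, d ∈ c.supersetsAvoiding (F \ c.1) → e ∈ d.1 → e ∈ c.1 := by
    intro c d hd hed
    by_contra hec
    exact Finset.disjoint_left.1 hd.2 hed (Finset.mem_sdiff.2 ⟨he, hec⟩)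
  exact Finset.disjoint_right.1 hF he
    (Finset.mem_inter.2 ⟨hmem_of a y hy hey, hmem_of b z hz hez⟩)

end Expn

/-- Every semiregular feebly compact `T1` semitopological semilattice topology
on `exp_n λ` is compact, and hence the operation `∩` is jointly continuous. -/
theorem semiregular_feeblyCompact_semitopological_is_compact
    {Λ : Type*} [DecidableEq Λ] [Infinite Λ] (n : ℕ) (hn : 0 < n)
    [TopologicalSpace (Expn Λ n)] [T1Space (Expn Λ n)]
    (hsr : SemiregularSp (Expn Λ n))
    (hfc : FeeblyCompactSp (Expn Λ n))
    (hsep : ∀ a : Expn Λ n, Continuous (Expn.inter a)) :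
    CompactSpace (Expn Λ n) ∧
      Continuous fun p : Expn Λ n × Expn Λ n => Expn.inter p.1 p.2 := by
  have h := fun (x : Expn Λ n) (U : Set (Expn Λ n)) (hU : U ∈ 𝓝 x) =>
    Expn.exists_supersetsAvoiding_subset hn hsep hsr hfc hU
  exact ⟨Expn.compactSpace_of_exists_supersetsAvoiding_subset h,
    Expn.continuous_inter_of_exists_supersetsAvoiding_subset
      (Expn.isOpen_supersetsAvoiding hn hsep) h⟩
end

section
/- Let λ be an infinite cardinal. There exists a Hausdorff (T1) topology τ on exp_2 λ such that the operation (x, y) ↦ x ∩ y is separately continuous but the space (exp_2 λ, τ) is not zero-dimensional, i.e., it does not have a base consisting of clopen sets. -/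
open Set Filter Topology TopologicalSpace

namespace Expn

variable {Λ : Type*} [DecidableEq Λ]

/-- The element `{x, y}` of `exp_2 λ`; it is the singleton `{x}` when `x = y`. -/
def pair (x y : Λ) : Expn Λ 2 := ⟨{x, y}, Finset.card_le_two⟩

/-- The empty subset of `λ`, as an element of `exp_2 λ`. -/
def empty : Expn Λ 2 := ⟨∅, by simp⟩

/-- The topology on `exp_2 λ` in which two-element sets are isolated, a neighbourhood of `{x}`
contains `{x, y}` for all but finitely many `y`, and a neighbourhood of `∅` contains all
two-element sets disjoint from some finite set. -/
@[reducible] def pairTopology (Λ : Type*) [DecidableEq Λ] : TopologicalSpace (Expn Λ 2) where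
  IsOpen U := (∀ x, pair x x ∈ U → ∃ F : Finset Λ, ∀ y ∉ F, pair x y ∈ U) ∧
    (empty ∈ U → ∃ F : Finset Λ, ∀ x ∉ F, ∀ y ∉ F, x ≠ y → pair x y ∈ U)
  isOpen_univ := by simp
  isOpen_inter := by
    rintro U V ⟨hU, hU'⟩ ⟨hV, hV'⟩
    refine ⟨fun x hx => ?_, fun h => ?_⟩
    · obtain ⟨F, hF⟩ := hU x hx.1
      obtain ⟨G, hG⟩ := hV x hx.2
      refine ⟨F ∪ G, fun y hy => ?_⟩
      rw [Finset.notMem_union] at hy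
      exact ⟨hF y hy.1, hG y hy.2⟩
    · obtain ⟨F, hF⟩ := hU' h.1
      obtain ⟨G, hG⟩ := hV' h.2
      refine ⟨F ∪ G, fun x hx y hy hxy => ?_⟩
      rw [Finset.notMem_union] at hx hy
      exact ⟨hF x hx.1 y hy.1 hxy, hG x hx.2 y hy.2 hxy⟩
  isOpen_sUnion := by
    refine fun S hS => ⟨fun x ⟨U, hU, hx⟩ => ?_, fun ⟨U, hU, h⟩ => ?_⟩
    · obtain ⟨F, hF⟩ := (hS U hU).1 x hx
      exact ⟨F, fun y hy => ⟨U, hU, hF y hy⟩⟩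
    · obtain ⟨F, hF⟩ := (hS U hU).2 h
      exact ⟨F, fun x hx y hy hxy => ⟨U, hU, hF x hx y hy hxy⟩⟩

theorem pairTopology_isOpen_iff {U : Set (Expn Λ 2)} :
    IsOpen[pairTopology Λ] U ↔
      (∀ x, pair x x ∈ U → ∃ F : Finset Λ, ∀ y ∉ F, pair x y ∈ U) ∧
        (empty ∈ U → ∃ F : Finset Λ, ∀ x ∉ F, ∀ y ∉ F, x ≠ y → pair x y ∈ U) :=
  Iff.rfl

/-- A set is open for `pairTopology` if membership in it depends only on the intersection with a
fixed finite set. -/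
theorem pairTopology_isOpen_inter_preimage (a : Finset Λ) (P : Finset Λ → Prop) :
    IsOpen[pairTopology Λ] {p : Expn Λ 2 | P (a ∩ p.1)} := by
  refine pairTopology_isOpen_iff.2 ⟨fun x hx => ⟨a, fun y hy => ?_⟩,
    fun h => ⟨a, fun x hx y hy _ => ?_⟩⟩
  · have : a ∩ {x, y} = a ∩ {x, x} := by ext z; simp; grind
    simpa only [mem_ofPred_eq, pair, this] using hx
  · have : a ∩ {x, y} = a ∩ ∅ := by ext z; simp; grind
    simpa only [mem_ofPred_eq, pair, empty, this] using h

theorem pairTopology_t2Space : @T2Space _ (pairTopology Λ) := by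
  let := pairTopology Λ
  refine ⟨fun p q hpq => ?_⟩
  have hne : ¬ ∀ x, x ∈ p.1 ↔ x ∈ q.1 := fun h => hpq (Subtype.ext (Finset.ext h))
  push Not at hne
  obtain ⟨x, hx⟩ := hne
  have h₁ : IsOpen {r : Expn Λ 2 | x ∈ r.1} := by
    simpa using pairTopology_isOpen_inter_preimage {x} (fun s => x ∈ s)
  have h₂ : IsOpen {r : Expn Λ 2 | x ∉ r.1} := by
    simpa using pairTopology_isOpen_inter_preimage {x} (fun s => x ∉ s)
  have hd : Disjoint {r : Expn Λ 2 | x ∈ r.1} {r : Expn Λ 2 | x ∉ r.1} :=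
    Set.disjoint_left.2 fun _ h h' => h' h
  rcases hx with ⟨hp, hq⟩ | ⟨hp, hq⟩
  · exact ⟨_, _, h₁, h₂, hp, hq, hd⟩
  · exact ⟨_, _, h₂, h₁, hp, hq, hd.symm⟩

theorem continuous_inter_pairTopology (a : Expn Λ 2) :
    Continuous[pairTopology Λ, pairTopology Λ] (inter a) := by
  let := pairTopology Λ
  refine ⟨fun U _ => ?_⟩
  convert pairTopology_isOpen_inter_preimage a.1 (fun s => ∃ h : s.card ≤ 2, ⟨s, h⟩ ∈ U) using 1
  ext p
  exact ⟨fun h => ⟨_, h⟩, fun ⟨_, h⟩ => h⟩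

theorem isOpen_compl_singletons :
    IsOpen[pairTopology Λ] {p : Expn Λ 2 | ∀ x, p ≠ pair x x} := by
  refine pairTopology_isOpen_iff.2 ⟨fun x hx => absurd rfl (hx x), fun _ => ⟨∅, ?_⟩⟩
  intro x _ y _ hxy z h
  have := congrArg (fun p : Expn Λ 2 => p.1.card) h
  simp [pair, Finset.card_pair hxy] at this

/-- Every clopen neighbourhood of `∅` for `pairTopology` contains a singleton. -/
theorem exists_singleton_mem_of_isClopen [Infinite Λ] {U : Set (Expn Λ 2)}
    (hU : @IsClopen _ (pairTopology Λ) U) (h : empty ∈ U) : ∃ x, pair x x ∈ U := by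
  let := pairTopology Λ
  obtain ⟨F, hF⟩ := (pairTopology_isOpen_iff.1 hU.isOpen).2 h
  obtain ⟨x, hx⟩ := Infinite.exists_notMem_finset F
  refine ⟨x, by_contra fun hxU => ?_⟩
  obtain ⟨G, hG⟩ := (pairTopology_isOpen_iff.1 hU.compl.isOpen).1 x hxU
  obtain ⟨y, hy⟩ := Infinite.exists_notMem_finset (insert x (F ∪ G))
  simp only [Finset.mem_insert, Finset.mem_union, not_or] at hy
  exact hG y hy.2.2 (hF x hx y hy.2.1 (Ne.symm hy.1))

end Expn

/-- There exists a Hausdorff topology `τ` on `exp_2 λ` with `∩` separately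
continuous such that `(exp_2 λ, τ)` is not zero-dimensional, i.e. it has no base of clopen
sets. -/
theorem exists_hausdorff_semitopological_exp2_not_zeroDimensional
    {Λ : Type*} [DecidableEq Λ] [Infinite Λ] :
    ∃ τ : TopologicalSpace (Expn Λ 2),
      @T2Space _ τ ∧
      (∀ a : Expn Λ 2, Continuous[τ, τ] (Expn.inter a)) ∧
      ¬ ∃ B : Set (Set (Expn Λ 2)), (∀ U ∈ B, @IsClopen _ τ U) ∧
          @TopologicalSpace.IsTopologicalBasis _ τ B := by
  refine ⟨Expn.pairTopology Λ, Expn.pairTopology_t2Space, Expn.continuous_inter_pairTopology, ?_⟩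
  rintro ⟨B, hB, hbasis⟩
  let := Expn.pairTopology Λ
  have hempty : (Expn.empty : Expn Λ 2) ∈ {p : Expn Λ 2 | ∀ x, p ≠ Expn.pair x x} := by
    intro x h
    simpa [Expn.empty, Expn.pair] using congrArg Subtype.val h
  obtain ⟨U, hUB, hU, hsub⟩ :=
    hbasis.exists_subset_of_mem_open hempty Expn.isOpen_compl_singletons
  obtain ⟨x, hx⟩ := Expn.exists_singleton_mem_of_isClopen (hB U hUB) hU
  exact hsub hx x rfl
end
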